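/- arXiv:2506.07264 — 3 statements merged into one kernel-verified Lean document; each statement's English description precedes it below -/
import Mathlib

section
/- Let G be a connected simple graph of order n ≥ 3 that has a dominating vertex (a vertex adjacent to all other vertices) and is not isomorphic to the star K_{1,n-1}. Then s⁺(G) ≥ n. -/
open Matrix

namespace SquareEnergy

theorem adj_isHermitian {V : Type*} [Fintype V] [DecidableEq V] (G : SimpleGraph V)
    [DecidableRel G.Adj] : (G.adjMatrix ℝ).IsHermitian :=
  ((G.adjMatrix ℝ).conjTranspose_eq_transpose_of_trivial).trans (SimpleGraph.isSymm_adjMatrix G)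

/-- The eigenvalues of the adjacency matrix of `G`, as a function `V → ℝ`. -/
noncomputable def adjEig {V : Type*} [Fintype V] [DecidableEq V] (G : SimpleGraph V) : V → ℝ :=
  letI := Classical.decRel G.Adj
  (adj_isHermitian G).eigenvalues

/-- Positive square energy `s⁺(G)`. -/
noncomputable def sPlus {V : Type*} [Fintype V] [DecidableEq V] (G : SimpleGraph V) : ℝ :=
  ∑ i, if 0 < adjEig G i then (adjEig G i) ^ 2 else 0

/-- Variational lower bound for the sum of the squares of the positive eigenvalues. -/
theorem two_mul_trace_sub_trace_sq_le {V : Type*} [Fintype V] [DecidableEq V]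
    {A X : Matrix V V ℝ} (hA : A.IsHermitian) (hX : X.PosSemidef) :
    2 * (A * X).trace - (X * X).trace ≤
      ∑ i, if 0 < hA.eigenvalues i then (hA.eigenvalues i) ^ 2 else 0 := by
  set U : Matrix V V ℝ := (hA.eigenvectorUnitary : Matrix V V ℝ) with hU
  set Y : Matrix V V ℝ := star U * X * U with hY
  have hUU : U * star U = 1 := Unitary.mul_star_self_of_mem hA.eigenvectorUnitary.2
  have hYpsd : Y.PosSemidef := hX.conjTranspose_mul_mul_same U
  have hspec : A = U * diagonal hA.eigenvalues * star U := by
    conv_lhs => rw [hA.spectral_theorem]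
    rw [Unitary.conjStarAlgAut_apply]
    rfl
  have htrAX : (A * X).trace = ∑ i, hA.eigenvalues i * Y i i := by
    have h : (A * X).trace = (diagonal hA.eigenvalues * Y).trace := by
      conv_lhs => rw [hspec]
      rw [Matrix.mul_assoc, Matrix.mul_assoc, trace_mul_comm, hY]
      simp only [Matrix.mul_assoc]
    rw [h]
    simp [trace, diagonal_mul]
  have htrXX : (X * X).trace = (Y * Y).trace := by
    have h : Y * Y = star U * (X * X * U) := by
      calc Y * Y = star U * X * (U * star U) * X * U := by simp only [hY, Matrix.mul_assoc]
        _ = star U * (X * X * U) := by rw [hUU]; simp only [Matrix.mul_assoc, Matrix.one_mul]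
    rw [h, trace_mul_comm (star U), Matrix.mul_assoc (X * X), hUU, Matrix.mul_one]
  have hdiag : ∑ i, Y i i ^ 2 ≤ (Y * Y).trace := by
    simp only [trace, diag_apply, Matrix.mul_apply]
    refine Finset.sum_le_sum fun i _ => ?_
    have hsymm : ∀ j, Y j i = Y i j := fun j => by simpa using hYpsd.isHermitian.apply i j
    simp only [hsymm, ← sq]
    exact Finset.single_le_sum (f := fun j => Y i j ^ 2) (fun j _ => sq_nonneg _)
      (Finset.mem_univ i)
  calc 2 * (A * X).trace - (X * X).trace
      ≤ ∑ i, (2 * (hA.eigenvalues i * Y i i) - Y i i ^ 2) := by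
        rw [Finset.sum_sub_distrib, ← Finset.mul_sum, htrAX, htrXX]
        linarith
    _ ≤ _ := by
        refine Finset.sum_le_sum fun i _ => ?_
        have hpos : 0 ≤ Y i i := hYpsd.diag_nonneg
        split_ifs with h
        · nlinarith [sq_nonneg (hA.eigenvalues i - Y i i)]
        · nlinarith [sq_nonneg (Y i i)]

/-- The variational bound applied to a nonnegative combination of two rank-one projections. -/
theorem le_sPlus_of_two_vectors {V : Type*} [Fintype V] [DecidableEq V] (G : SimpleGraph V)
    [DecidableRel G.Adj] {a b : ℝ} (ha : 0 ≤ a) (hb : 0 ≤ b) (y z : V → ℝ) :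
    2 * (a * (y ⬝ᵥ G.adjMatrix ℝ *ᵥ y) + b * (z ⬝ᵥ G.adjMatrix ℝ *ᵥ z)) -
      (a ^ 2 * (y ⬝ᵥ y) ^ 2 + 2 * (a * b) * (y ⬝ᵥ z) ^ 2 + b ^ 2 * (z ⬝ᵥ z) ^ 2) ≤ sPlus G := by
  have hy : (vecMulVec y y).PosSemidef := by
    simpa using posSemidef_vecMulVec_self_star y
  have hz : (vecMulVec z z).PosSemidef := by
    simpa using posSemidef_vecMulVec_self_star z
  have h := two_mul_trace_sub_trace_sq_le (adj_isHermitian G) ((hy.smul ha).add (hz.smul hb))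
  have heq : sPlus G = ∑ i, if 0 < (adj_isHermitian G).eigenvalues i then
      ((adj_isHermitian G).eigenvalues i) ^ 2 else 0 := by
    unfold sPlus adjEig
    congr!
  rw [heq]
  refine le_trans (le_of_eq ?_) h
  simp only [Matrix.mul_add, Matrix.mul_smul, trace_add, trace_smul, mul_vecMulVec,
    trace_vecMulVec, smul_eq_mul, add_mulVec, smul_mulVec, vecMulVec_mulVec, op_smul_eq_smul,
    add_dotProduct, smul_dotProduct, dotProduct_comm z y, dotProduct_comm (G.adjMatrix ℝ *ᵥ _)]
  ring

/-- A graph with a dominating vertex `v` and no edge avoiding `v` is a star. -/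
theorem nonempty_iso_star {V : Type*} [Fintype V] [DecidableEq V] (G : SimpleGraph V) (v : V)
    (hv : ∀ w, w ≠ v → G.Adj v w) (h : ∀ u w, u ≠ v → w ≠ v → ¬ G.Adj u w) :
    Nonempty (G ≃g completeBipartiteGraph (Fin 1) (Fin (Fintype.card V - 1))) := by
  have e₁ : {a // a = v} ≃ Fin 1 := Fintype.equivFinOfCardEq (by simp)
  have e₂ : {a // ¬ a = v} ≃ Fin (Fintype.card V - 1) :=
    Fintype.equivFinOfCardEq (by simp [Fintype.card_subtype_compl])
  refine ⟨⟨(Equiv.sumCompl (· = v)).symm.trans (e₁.sumCongr e₂), ?_⟩⟩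
  intro a b
  by_cases ha : a = v <;> by_cases hb : b = v
  · subst ha; subst hb; simp
  · subst ha
    simp [Equiv.sumCompl_symm_apply_of_neg, hb, hv b hb]
  · subst hb
    simp [Equiv.sumCompl_symm_apply_of_neg, ha, (hv a ha).symm]
  · simp [Equiv.sumCompl_symm_apply_of_neg, ha, hb, h a b ha hb]

/-- A dominating vertex has degree `n - 1`. -/
theorem degree_add_one_of_dominating {V : Type*} [Fintype V] [DecidableEq V] (G : SimpleGraph V)
    [DecidableRel G.Adj] {v : V} (hv : ∀ w, w ≠ v → G.Adj v w) :
    G.degree v + 1 = Fintype.card V := by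
  have h : insert v (G.neighborFinset v) = Finset.univ := by
    ext x
    by_cases hx : x = v <;> simp [hx, hv]
  rw [← G.card_neighborFinset_eq_degree,
    ← Finset.card_insert_of_notMem (s := G.neighborFinset v) (a := v) (by simp), h,
    Finset.card_univ]

/-- A dominating vertex and an edge avoiding it force degree sum at least `2n`. -/
theorem two_mul_card_le_sum_degrees {V : Type*} [Fintype V] [DecidableEq V] (G : SimpleGraph V)
    [DecidableRel G.Adj] {v u w : V} (hv : ∀ x, x ≠ v → G.Adj v x) (hu : u ≠ v) (hw : w ≠ v)
    (huw : G.Adj u w) : 2 * Fintype.card V ≤ ∑ x, G.degree x := by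
  have hdv := degree_add_one_of_dominating G hv
  have hone : ∀ x, x ≠ v → 1 ≤ G.degree x := fun x hx =>
    (G.degree_pos_iff_exists_adj x).2 ⟨v, (hv x hx).symm⟩
  have htwo : ∀ x y, x ≠ v → y ≠ v → G.Adj x y → 2 ≤ G.degree x := fun x y hx hy hxy => by
    rw [← G.card_neighborFinset_eq_degree, ← Finset.card_pair hy]
    refine Finset.card_le_card fun z hz => ?_
    rcases Finset.mem_insert.1 hz with rfl | hz
    · simpa using hxy
    · rw [Finset.mem_singleton.1 hz]
      simpa using (hv x hx).symm
  have hle : ∀ x, 1 + (if x = v then G.degree v - 1 else 0) + (if x = u then 1 else 0) +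
      (if x = w then 1 else 0) ≤ G.degree x := fun x => by
    have hne := huw.ne
    have hvu : 1 ≤ G.degree v := (G.degree_pos_iff_exists_adj v).2 ⟨u, hv u hu⟩
    have h₁ := hone x
    have h₂ := htwo u w hu hw huw
    have h₃ := htwo w u hw hu huw.symm
    by_cases hxv : x = v
    · subst hxv
      simp [hu.symm, hw.symm]
      omega
    · by_cases hxu : x = u
      · subst hxu
        simp [hu, hne]
        omega
      · by_cases hxw : x = w
        · subst hxw
          simp [hw, hne.symm]
          omega
        · simp [hxv, hxu, hxw]
          exact (hv x hxv).symm.degree_pos_left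
  have hsum := Finset.sum_le_sum fun x (_ : x ∈ Finset.univ) => hle x
  simp only [Finset.sum_add_distrib, Finset.sum_ite_eq', Finset.mem_univ, if_true,
    Finset.sum_const, Finset.card_univ, smul_eq_mul, mul_one] at hsum
  have hvu : 1 ≤ G.degree v := (G.degree_pos_iff_exists_adj v).2 ⟨u, hv u hu⟩
  omega

/-- A connected graph of order `n ≥ 3` with a dominating vertex which is not the star
`K_{1,n-1}` satisfies `s⁺(G) ≥ n`. -/
theorem stmt_2 {V : Type*} [Fintype V] [DecidableEq V] (G : SimpleGraph V) [DecidableRel G.Adj]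
    (hn : 3 ≤ Fintype.card V) (hconn : G.Connected)
    (hdom : ∃ v : V, ∀ w : V, w ≠ v → G.Adj v w)
    (hstar : IsEmpty (G ≃g completeBipartiteGraph (Fin 1) (Fin (Fintype.card V - 1)))) :
    (Fintype.card V : ℝ) ≤ sPlus G := by
  obtain ⟨v, hv⟩ := hdom
  obtain ⟨u, w, hu, hw, huw⟩ : ∃ u w, u ≠ v ∧ w ≠ v ∧ G.Adj u w := by
    by_contra! h
    exact (nonempty_iso_star G v hv h).elim hstar.elim
  set k : ℝ := (Fintype.card V : ℝ) - 1 with hk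
  have hkpos : 0 < k := by
    have : (3 : ℝ) ≤ Fintype.card V := by exact_mod_cast hn
    linarith
  set s : ℝ := √k
  have hs : 0 < s := Real.sqrt_pos.2 hkpos
  have hss : s ^ 2 = k := Real.sq_sqrt hkpos.le
  have hdv : (G.degree v : ℝ) = k := by
    rw [hk, ← degree_add_one_of_dominating G hv]
    push_cast
    ring
  have hdeg : 2 * (Fintype.card V : ℝ) ≤ ∑ x, (G.degree x : ℝ) := by
    exact_mod_cast two_mul_card_le_sum_degrees G hv hu hw huw
  set y : V → ℝ := 1 + Pi.single v (s - 1) with hy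
  set z : V → ℝ := Pi.single u 1 + Pi.single w 1 with hz
  have hyy : y ⬝ᵥ y = 2 * k := by
    simp [hy, dotProduct_add, add_dotProduct]
    linarith
  have hyz : y ⬝ᵥ z = 2 := by
    simp [hy, hz, dotProduct_add, hu, hw]
    norm_num
  have hzz : z ⬝ᵥ z = 2 := by
    simp [hz, dotProduct_add, huw.ne, huw.ne.symm]
    norm_num
  have hyA : 2 * k * s + 2 ≤ y ⬝ᵥ G.adjMatrix ℝ *ᵥ y := by
    have h1 : (1 : V → ℝ) ⬝ᵥ G.adjMatrix ℝ *ᵥ 1 = ∑ x, (G.degree x : ℝ) := by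
      simp [one_dotProduct, SimpleGraph.adjMatrix_mulVec_apply]
    have h2 : (Pi.single v (s - 1)) ⬝ᵥ G.adjMatrix ℝ *ᵥ 1 = (s - 1) * k := by
      simp [SimpleGraph.adjMatrix_mulVec_apply, hdv]
    have h3 : (1 : V → ℝ) ⬝ᵥ G.adjMatrix ℝ *ᵥ (Pi.single v (s - 1)) = (s - 1) * k := by
      rw [dotProduct_mulVec, ← mulVec_transpose, SimpleGraph.transpose_adjMatrix,
        dotProduct_comm, h2]
    have h4 : (Pi.single v (s - 1)) ⬝ᵥ G.adjMatrix ℝ *ᵥ (Pi.single v (s - 1)) = 0 := by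
      simp [SimpleGraph.adjMatrix_apply]
    rw [hy, mulVec_add, dotProduct_add, add_dotProduct, add_dotProduct, h1, h2, h3, h4]
    linarith
  have hzA : z ⬝ᵥ G.adjMatrix ℝ *ᵥ z = 2 := by
    simp [hz, mulVec_add, dotProduct_add, add_dotProduct, huw, huw.symm]
    norm_num
  have hmain := le_sPlus_of_two_vectors G (a := 1 / (2 * s)) (b := 1 / 2) (by positivity)
    (by norm_num) y z
  rw [hyy, hyz, hzz, hzA] at hmain
  have hstep := mul_le_mul_of_nonneg_left hyA (show 0 ≤ 1 / (2 * s) by positivity)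
  have hval : (Fintype.card V : ℝ) = 2 * (1 / (2 * s) * (2 * k * s + 2) + 1 / 2 * 2) -
      ((1 / (2 * s)) ^ 2 * (2 * k) ^ 2 + 2 * (1 / (2 * s) * (1 / 2)) * 2 ^ 2 +
        (1 / 2) ^ 2 * 2 ^ 2) := by
    rw [show (Fintype.card V : ℝ) = k + 1 by simp [hk], ← hss]
    field_simp
    ring
  linarith

end SquareEnergy
end

section
/- Let G be a simple graph and let U be a set of three vertices of G such that the induced subgraph G[U] is isomorphic to the path P_3 on three vertices. Then there exists a vertex u ∈ U such that s⁻(G) ≥ s⁻(G − u) + 1 + 1/16, where G − u denotes the induced subgraph obtained by deleting u. -/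
open Matrix

namespace SquareEnergy

/-- Negative square energy `s⁻(G)`. -/
noncomputable def sMinus {V : Type*} [Fintype V] [DecidableEq V] (G : SimpleGraph V) : ℝ :=
  ∑ i, if adjEig G i < 0 then (adjEig G i) ^ 2 else 0

theorem trace_conjTranspose_mul_self_eq_sum_sq {n : Type*} [Fintype n] (Q : Matrix n n ℝ) :
    (Qᴴ * Q).trace = ∑ i, ∑ j, Q i j ^ 2 := by
  rw [Finset.sum_comm]
  simp [Matrix.trace, Matrix.mul_apply, sq]

section Frobenius

variable {n : Type*} [Fintype n] [DecidableEq n]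

theorem sum_sq_unitary_conj {W : Matrix n n ℝ} (hW : W * Wᴴ = 1) (Q : Matrix n n ℝ) :
    ∑ i, ∑ j, (Wᴴ * Q * W) i j ^ 2 = ∑ i, ∑ j, Q i j ^ 2 := by
  rw [← trace_conjTranspose_mul_self_eq_sum_sq, ← trace_conjTranspose_mul_self_eq_sum_sq]
  calc ((Wᴴ * Q * W)ᴴ * (Wᴴ * Q * W)).trace
      = (Wᴴ * (Qᴴ * (W * Wᴴ) * Q * W)).trace := by
        simp only [conjTranspose_mul, conjTranspose_conjTranspose, Matrix.mul_assoc]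
    _ = (Qᴴ * Q * (W * Wᴴ)).trace := by
        rw [Matrix.trace_mul_comm, hW, Matrix.mul_one, Matrix.mul_assoc (Qᴴ * Q), hW]
    _ = (Qᴴ * Q).trace := by rw [hW, Matrix.mul_one]

theorem exists_orthogonal_diagonalization {A : Matrix n n ℝ} (hA : A.IsHermitian) :
    ∃ W : Matrix n n ℝ, W * Wᴴ = 1 ∧ Wᴴ * W = 1 ∧ A = W * diagonal hA.eigenvalues * Wᴴ := by
  refine ⟨hA.eigenvectorUnitary, ?_, ?_, ?_⟩
  · exact Unitary.coe_mul_star_self hA.eigenvectorUnitary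
  · exact Unitary.coe_star_mul_self hA.eigenvectorUnitary
  · exact hA.spectral_theorem

/-- The sum of the squares of the negative eigenvalues is a lower bound for the squared Frobenius
distance to the positive semidefinite cone. -/
theorem sum_sq_neg_eigenvalues_le {A Q : Matrix n n ℝ} (hA : A.IsHermitian)
    (hAQ : (A + Q).PosSemidef) :
    ∑ i, (if hA.eigenvalues i < 0 then hA.eigenvalues i ^ 2 else 0) ≤ ∑ i, ∑ j, Q i j ^ 2 := by
  obtain ⟨W, hW, hW', hspec⟩ := exists_orthogonal_diagonalization hA
  have hconj : Wᴴ * (A + Q) * W = diagonal hA.eigenvalues + Wᴴ * Q * W := by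
    have : Wᴴ * A * W = diagonal hA.eigenvalues := by
      conv_lhs => rw [hspec]
      calc Wᴴ * (W * diagonal hA.eigenvalues * Wᴴ) * W
          = (Wᴴ * W) * diagonal hA.eigenvalues * (Wᴴ * W) := by simp only [Matrix.mul_assoc]
        _ = _ := by rw [hW', Matrix.one_mul, Matrix.mul_one]
    rw [Matrix.mul_add, Matrix.add_mul, this]
  have hpsd := hAQ.conjTranspose_mul_mul_same W
  rw [hconj] at hpsd
  rw [← sum_sq_unitary_conj hW Q]
  refine Finset.sum_le_sum fun i _ => ?_
  have hdiag : 0 ≤ hA.eigenvalues i + (Wᴴ * Q * W) i i := by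
    simpa using hpsd.diag_nonneg (i := i)
  calc (if hA.eigenvalues i < 0 then hA.eigenvalues i ^ 2 else 0)
      ≤ (Wᴴ * Q * W) i i ^ 2 := by
        split_ifs with h
        · nlinarith
        · positivity
    _ ≤ _ := Finset.single_le_sum (f := fun j => (Wᴴ * Q * W) i j ^ 2)
        (fun j _ => sq_nonneg _) (Finset.mem_univ i)

/-- The negative part of a symmetric matrix attains the distance to the positive semidefinite
cone. -/
theorem exists_negPart {A : Matrix n n ℝ} (hA : A.IsHermitian) :
    ∃ Y : Matrix n n ℝ, Y.IsHermitian ∧ (A + Y).PosSemidef ∧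
      ∑ i, ∑ j, Y i j ^ 2 =
        ∑ i, (if hA.eigenvalues i < 0 then hA.eigenvalues i ^ 2 else 0) := by
  obtain ⟨W, hW, hW', hspec⟩ := exists_orthogonal_diagonalization hA
  let μ : n → ℝ := fun i => max (-hA.eigenvalues i) 0
  refine ⟨W * diagonal μ * Wᴴ, ?_, ?_, ?_⟩
  · exact isHermitian_mul_mul_conjTranspose W (isHermitian_diagonal μ)
  · have : A + W * diagonal μ * Wᴴ = W * diagonal (hA.eigenvalues + μ) * Wᴴ := by
      conv_lhs => rw [hspec]
      rw [← Matrix.add_mul, ← Matrix.mul_add, diagonal_add]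
      rfl
    rw [this]
    refine (PosSemidef.diagonal fun i => ?_).mul_mul_conjTranspose_same W
    simp only [Pi.zero_apply, Pi.add_apply, μ]
    linarith [le_max_left (-hA.eigenvalues i) 0]
  · rw [← sum_sq_unitary_conj hW]
    have : Wᴴ * (W * diagonal μ * Wᴴ) * W = diagonal μ := by
      calc Wᴴ * (W * diagonal μ * Wᴴ) * W
          = (Wᴴ * W) * diagonal μ * (Wᴴ * W) := by simp only [Matrix.mul_assoc]
        _ = _ := by rw [hW', Matrix.one_mul, Matrix.mul_one]
    rw [this]
    refine Finset.sum_congr rfl fun i _ => ?_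
    rw [Finset.sum_eq_single i (fun j _ hj => by simp [diagonal_apply_ne' _ hj]) (by simp),
      diagonal_apply_eq]
    split_ifs with h
    · simp only [μ]
      rw [max_eq_left (by linarith), neg_sq]
    · simp only [μ]
      rw [max_eq_right (by linarith)]
      simp

/-- Deleting row and column `u` decreases the squared Frobenius norm of a symmetric matrix by at
least the contribution of the entries at `u` and two further positions. -/
theorem sum_sq_submatrix_add_le {Y : Matrix n n ℝ} (hY : Y.IsHermitian) {u v w : n}
    (hv : v ≠ u) (hw : w ≠ u) (hvw : v ≠ w) :
    (∑ i : {x // x ≠ u}, ∑ j : {x // x ≠ u}, Y i j ^ 2)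
      + (2 * (Y u v ^ 2 + Y u w ^ 2) + Y u u ^ 2) ≤ ∑ i, ∑ j, Y i j ^ 2 := by
  have hsymm : ∀ i j, Y i j = Y j i := fun i j => by simpa using hY.apply j i
  have hrow : Y u v ^ 2 + Y u w ^ 2 ≤ ∑ j : {x // x ≠ u}, Y u j ^ 2 := by
    have hne : (⟨v, hv⟩ : {x // x ≠ u}) ≠ ⟨w, hw⟩ := fun h => hvw (congrArg Subtype.val h)
    have := Finset.sum_le_univ_sum_of_nonneg (f := fun j : {x // x ≠ u} => Y u j ^ 2)
      (s := {⟨v, hv⟩, ⟨w, hw⟩}) (fun j => sq_nonneg _)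
    rwa [Finset.sum_pair hne] at this
  have hsplit : ∑ i, ∑ j, Y i j ^ 2 = Y u u ^ 2 + 2 * (∑ j : {x // x ≠ u}, Y u j ^ 2)
      + ∑ i : {x // x ≠ u}, ∑ j : {x // x ≠ u}, Y i j ^ 2 := by
    simp only [Fintype.sum_eq_add_sum_subtype_ne _ u, Finset.sum_add_distrib]
    have : ∑ i : {x // x ≠ u}, Y i u ^ 2 = ∑ j : {x // x ≠ u}, Y u j ^ 2 :=
      Finset.sum_congr rfl fun i _ => by rw [hsymm]
    rw [this]
    ring
  rw [hsplit]
  linarith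

end Frobenius

/-- The quadratic form of a positive semidefinite matrix at a vector `(1, t, 1)` supported on three
indices gives a discriminant inequality. -/
theorem PosSemidef.sq_add_le {n : Type*} {M : Matrix n n ℝ} (hM : M.PosSemidef) (a b c : n) :
    (M a b + M b c) ^ 2 ≤ M b b * (M a a + M c c + 2 * M a c) := by
  have hsymm : ∀ i j, M i j = M j i := fun i j => by simpa using hM.isHermitian.apply j i
  have hquad : ∀ t : ℝ, 0 ≤ M b b * (t * t) + (2 * (M a b + M b c)) * t
      + (M a a + M c c + 2 * M a c) := by
    intro t
    have h := (hM.submatrix ![a, b, c]).dotProduct_mulVec_nonneg ![1, t, 1]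
    simp [dotProduct, mulVec, Fin.sum_univ_three] at h
    rw [hsymm b a, hsymm c a, hsymm c b] at h
    linarith
  have := discrim_le_zero hquad
  rw [discrim] at this
  linarith

theorem path_quartic_pos {P : ℝ} (hP : 4 * P ^ 2 ≤ 17 / 16) :
    3 / 2 * (17 / 16 - 2 * P ^ 2) * (17 / 16 - 4 * P ^ 2) < 4 * (1 - P) ^ 4 := by
  have hP' : P ≤ 13 / 25 := by nlinarith
  nlinarith [mul_nonneg (sub_nonneg.2 hP) (sq_nonneg (P - 0.343)),
    mul_nonneg (sub_nonneg.2 hP') (sq_nonneg (P - 0.343)), sq_nonneg (P - 0.343)]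

theorem path_entries_bound {x y z p q r : ℝ}
    (h : (1 + p + (1 + q)) ^ 2 ≤ y * (x + z + 2 * r)) :
    17 / 16 ≤ 2 * (p ^ 2 + r ^ 2) + x ^ 2 ∨ 17 / 16 ≤ 2 * (p ^ 2 + q ^ 2) + y ^ 2 ∨
      17 / 16 ≤ 2 * (r ^ 2 + q ^ 2) + z ^ 2 := by
  by_contra! hcon
  obtain ⟨hx, hy, hz⟩ := hcon
  obtain ⟨P, hP⟩ : ∃ P, P = -(p + q) / 2 := ⟨_, rfl⟩
  obtain ⟨S, hS⟩ : ∃ S, S = (x + z) / 2 + r := ⟨_, rfl⟩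
  have hPpq : 2 * P ^ 2 ≤ p ^ 2 + q ^ 2 := by
    subst hP; nlinarith [sq_nonneg (p - q)]
  have hy' : y ^ 2 ≤ 17 / 16 - 4 * P ^ 2 := by linarith
  have hS' : S ^ 2 ≤ 3 / 2 * (17 / 16 - 2 * P ^ 2) := by
    subst hS
    nlinarith [sq_nonneg (x - z), sq_nonneg ((x + z) / 2 - 2 * r)]
  have hyS : 2 * (1 - P) ^ 2 ≤ y * S := by
    subst hS hP; linarith
  have hquartic := path_quartic_pos (P := P) (by nlinarith [sq_nonneg y])
  have h1 : (2 * (1 - P) ^ 2) ^ 2 ≤ (y * S) ^ 2 := pow_le_pow_left₀ (by positivity) hyS 2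
  have h2 : S ^ 2 * y ^ 2 ≤ 3 / 2 * (17 / 16 - 2 * P ^ 2) * (17 / 16 - 4 * P ^ 2) :=
    mul_le_mul hS' hy' (sq_nonneg y) ((sq_nonneg S).trans hS')
  linarith

theorem sMinus_eq {V : Type*} [Fintype V] [DecidableEq V] (G : SimpleGraph V)
    [DecidableRel G.Adj] :
    sMinus G = ∑ i, if (adj_isHermitian G).eigenvalues i < 0 then
      (adj_isHermitian G).eigenvalues i ^ 2 else 0 := by
  unfold sMinus adjEig
  congr!

theorem sMinus_induce_ne_le {V : Type*} [Fintype V] [DecidableEq V] (G : SimpleGraph V)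
    [DecidableRel G.Adj] {Y : Matrix V V ℝ} (hY : (G.adjMatrix ℝ + Y).PosSemidef) (u : V) :
    sMinus (G.induce {v : V | v ≠ u}) ≤ ∑ i : {x // x ≠ u}, ∑ j : {x // x ≠ u}, Y i j ^ 2 := by
  classical
  rw [sMinus_eq]
  refine (sum_sq_neg_eigenvalues_le (Q := Y.submatrix Subtype.val Subtype.val) _ ?_).trans_eq ?_
  · convert hY.submatrix (Subtype.val : {v : V | v ≠ u} → V) using 1
    ext i j
    simp [SimpleGraph.adjMatrix_apply]
  · rfl

/-- The `P₃`-removal lemma for `s⁻`: if `U` is a set of three vertices inducing a path `P₃`,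
then some `u ∈ U` satisfies `s⁻(G) ≥ s⁻(G - u) + 1 + 1/16`. -/
theorem stmt_5 {V : Type*} [Fintype V] [DecidableEq V] (G : SimpleGraph V) [DecidableRel G.Adj]
    (U : Finset V) (hU3 : U.card = 3)
    (hP3 : Nonempty ((G.induce (U : Set V)) ≃g SimpleGraph.pathGraph 3)) :
    ∃ u ∈ U, sMinus (G.induce {v : V | v ≠ u}) + 1 + 1 / 16 ≤ sMinus G := by
  obtain ⟨e⟩ := hP3
  obtain ⟨f, hf⟩ : ∃ f : Fin 3 → V, f = fun i => (e.symm i : V) := ⟨_, rfl⟩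
  have hmem : ∀ i, f i ∈ U := fun i => by subst hf; exact (e.symm i).2
  have hinj : Function.Injective f := by
    subst hf; exact Subtype.val_injective.comp e.symm.injective
  have hadj : ∀ i j, G.Adj (f i) (f j) ↔ (SimpleGraph.pathGraph 3).Adj i j := fun i j => by
    subst hf; exact e.symm.map_rel_iff
  have h01 : G.Adj (f 0) (f 1) := by rw [hadj, SimpleGraph.pathGraph_adj]; decide
  have h12 : G.Adj (f 1) (f 2) := by rw [hadj, SimpleGraph.pathGraph_adj]; decide
  have h02 : ¬ G.Adj (f 0) (f 2) := by rw [hadj, SimpleGraph.pathGraph_adj]; decide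
  have n01 : f 0 ≠ f 1 := hinj.ne (by decide)
  have n12 : f 1 ≠ f 2 := hinj.ne (by decide)
  have n02 : f 0 ≠ f 2 := hinj.ne (by decide)
  obtain ⟨Y, hYh, hYpsd, hYsum⟩ := exists_negPart (adj_isHermitian G)
  rw [← sMinus_eq] at hYsum
  have hsymm : ∀ i j, Y i j = Y j i := fun i j => by simpa using hYh.apply j i
  have hremove : ∀ u v w : V, u ∈ U → v ≠ u → w ≠ u → v ≠ w →
      17 / 16 ≤ 2 * (Y u v ^ 2 + Y u w ^ 2) + Y u u ^ 2 →
      ∃ u ∈ U, sMinus (G.induce {v : V | v ≠ u}) + 1 + 1 / 16 ≤ sMinus G := by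
    intro u v w hu hv hw hvw hbound
    refine ⟨u, hu, ?_⟩
    have h1 := sMinus_induce_ne_le G hYpsd u
    have h2 := sum_sq_submatrix_add_le hYh hv hw hvw
    linarith
  have hdisc := PosSemidef.sq_add_le hYpsd (f 0) (f 1) (f 2)
  simp only [Matrix.add_apply, SimpleGraph.adjMatrix_apply, h01, h12, h02, SimpleGraph.irrefl,
    if_true, if_false, zero_add] at hdisc
  rcases path_entries_bound hdisc with h | h | h
  · exact hremove (f 0) (f 1) (f 2) (hmem 0) n01.symm n02.symm n12 h
  · exact hremove (f 1) (f 0) (f 2) (hmem 1) n01 n12.symm n02 (by rwa [hsymm (f 1) (f 0)])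
  · exact hremove (f 2) (f 0) (f 1) (hmem 2) n02 n12 n01
      (by rwa [hsymm (f 2) (f 0), hsymm (f 2) (f 1)])

end SquareEnergy
end

section
/- Let A be a real symmetric n×n matrix and write A = A⁺ − A⁻ for its spectral decomposition into positive and negative parts. Then the infimum of tr((A + M)²) over all positive semidefinite n×n real matrices M equals tr((A⁺)²), and this infimum is attained at M = A⁻. -/
open Matrix
open scoped MatrixOrder

namespace SquareEnergy

/-- The trace of a product of two positive semidefinite real matrices is nonnegative. -/
theorem trace_mul_nonneg {ι : Type*} [Fintype ι] {P Q : Matrix ι ι ℝ}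
    (hP : P.PosSemidef) (hQ : Q.PosSemidef) : 0 ≤ (P * Q).trace := by
  classical
  obtain ⟨B, rfl⟩ := CStarAlgebra.nonneg_iff_eq_star_mul_self.mp hQ.nonneg
  rw [Matrix.star_eq_conjTranspose, ← Matrix.mul_assoc, Matrix.trace_mul_comm, ← Matrix.mul_assoc]
  exact (hP.mul_mul_conjTranspose_same B).trace_nonneg

/-- The trace of the square of a Hermitian real matrix is nonnegative. -/
theorem trace_sq_nonneg {ι : Type*} [Fintype ι] [DecidableEq ι] {C : Matrix ι ι ℝ}
    (hC : C.IsHermitian) : 0 ≤ (C ^ 2).trace := by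
  have h := (Matrix.posSemidef_conjTranspose_mul_self C).trace_nonneg
  rwa [hC.eq, ← sq] at h

/-- For a real symmetric matrix `A` with spectral decomposition `A = A⁺ − A⁻` into positive and
negative parts, the infimum of `tr((A + M)²)` over positive semidefinite `M` equals `tr((A⁺)²)`,
and it is attained at `M = A⁻`. -/
theorem stmt_7 {n : ℕ} (A Ap Am : Matrix (Fin n) (Fin n) ℝ)
    (hA : A.IsSymm) (hAp : Ap.PosSemidef) (hAm : Am.PosSemidef)
    (hmul : Ap * Am = 0) (hdecomp : A = Ap - Am) :
    IsLeast {x : ℝ | ∃ M : Matrix (Fin n) (Fin n) ℝ, M.PosSemidef ∧ x = ((A + M) ^ 2).trace}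
      ((Ap ^ 2).trace) ∧
    ((A + Am) ^ 2).trace = (Ap ^ 2).trace := by
  have hattained : ((A + Am) ^ 2).trace = (Ap ^ 2).trace := by
    rw [hdecomp, sub_add_cancel]
  refine ⟨⟨⟨Am, hAm, hattained.symm⟩, ?_⟩, hattained⟩
  rintro x ⟨M, hM, rfl⟩
  have hexpand : (A + M) ^ 2 =
      Ap ^ 2 + Ap * (M - Am) + (M - Am) * Ap + (M - Am) ^ 2 := by
    rw [hdecomp]
    noncomm_ring
  have hcross : (Ap * (M - Am)).trace = (Ap * M).trace := by
    rw [mul_sub, hmul, sub_zero]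
  rw [hexpand, Matrix.trace_add, Matrix.trace_add, Matrix.trace_add,
    Matrix.trace_mul_comm (M - Am), hcross]
  linarith [trace_mul_nonneg hAp hM, trace_sq_nonneg (hM.isHermitian.sub hAm.isHermitian)]

end SquareEnergy
end
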